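/- There exist constants C > c > 0 and, for each fixed k ≥ 0, a threshold G such that for all even g ≥ G the number N(g,k) of compact orientable 3-manifolds admitting an ideal triangulation with g+k tetrahedra and boundary Σ_g ⊔ (k tori) satisfies g^{c·g} < N(g,k) < g^{C·g}. -/

import Mathlib

/-- A simplicial face-pairing of `n` tetrahedra: the `4n` faces (a face of tetrahedron `t` is
labeled by the opposite vertex `i`, i.e. by `(t, i)`) are glued in pairs (`pair` is a
fixed-point-free involution), and each face is glued to its partner via a simplicial map,
encoded by the induced vertex bijection `glue f : Fin 4 ≃ Fin 4` (which sends the vertex `f.2`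
opposite the face `f` to the vertex opposite the partner face). -/
structure FacePairing (n : ℕ) where
  pair : Equiv.Perm (Fin n × Fin 4)
  pair_invol : ∀ f, pair (pair f) = f
  pair_ne : ∀ f, pair f ≠ f
  glue : Fin n × Fin 4 → Fin 4 ≃ Fin 4
  glue_vertex : ∀ f, glue f f.2 = (pair f).2
  glue_compat : ∀ f, glue (pair f) = (glue f).symm

namespace FacePairing

/-- A face-pairing is oriented when all gluing maps are orientation-reversing, i.e. odd
permutations of the vertices (the tetrahedra all being coherently oriented); the resulting
ideal triangulation then yields an orientable manifold. -/
def Oriented {n : ℕ} (P : FacePairing n) : Prop :=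
  ∀ f, Equiv.Perm.sign (P.glue f) = -1

variable {n : ℕ} (P : FacePairing n)

/-- One step of the identification of vertex instances `(tetrahedron, vertex)` induced by the
face gluings: glue across the face `(a.1, i)` containing the vertex `a.2` (i.e. `i ≠ a.2`). -/
def vrel (a b : Fin n × Fin 4) : Prop :=
  ∃ i : Fin 4, i ≠ a.2 ∧ b = ((P.pair (a.1, i)).1, P.glue (a.1, i) a.2)

/-- Vertices of the glued complex: instances modulo the identifications. -/
def VertexClass := Quot P.vrel

/-- A corner instance `(t, v, w)`: the end at the vertex `v` of the edge `vw` of tetrahedron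
`t`.  These are the triangle-vertices of the boundary (link) surfaces. -/
def Corner (n : ℕ) := {c : Fin n × Fin 4 × Fin 4 // c.2.1 ≠ c.2.2}

/-- One step of the identification of corners induced by the face gluings. -/
def crel (a b : Corner n) : Prop :=
  ∃ i : Fin 4, i ≠ a.1.2.1 ∧ i ≠ a.1.2.2 ∧
    b.1 = ((P.pair (a.1.1, i)).1, P.glue (a.1.1, i) a.1.2.1, P.glue (a.1.1, i) a.1.2.2)

/-- Vertices of the links (boundary surfaces): corners modulo identification. -/
def LinkVertexClass := Quot P.crel

/-- The number of link triangles in the boundary component corresponding to the vertex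
class `c`: one triangle for each vertex instance in the class. -/
noncomputable def linkTriangles (c : P.VertexClass) : ℕ :=
  Nat.card {a : Fin n × Fin 4 // Quot.mk P.vrel a = c}

/-- The number of vertices of the link surface of the vertex class `c`. -/
noncomputable def linkVertices (c : P.VertexClass) : ℕ :=
  Nat.card {l : P.LinkVertexClass //
    ∃ a : Corner n, Quot.mk P.crel a = l ∧ Quot.mk P.vrel (a.1.1, a.1.2.1) = c}

/-- Twice the Euler characteristic of the boundary component corresponding to the vertex class
`c`: the link is a closed surface with `F` triangles, `3F/2` edges and `V` vertices, so
`2χ = 2V - 3F + 2F = 2V - F`. -/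
noncomputable def eulerChar2 (c : P.VertexClass) : ℤ :=
  2 * (P.linkVertices c : ℤ) - (P.linkTriangles c : ℤ)

/-- The boundary of the glued manifold is `Σ_g ⊔ (k tori)`: there are `1 + k` boundary
components (vertex classes), one of Euler characteristic `2 - 2g` and `k` of Euler
characteristic `0`. -/
def BoundaryIs (g k : ℕ) : Prop :=
  Nat.card P.VertexClass = 1 + k ∧
  ∃ c₀ : P.VertexClass, P.eulerChar2 c₀ = 2 * (2 - 2 * (g : ℤ)) ∧
    ∀ c : P.VertexClass, c ≠ c₀ → P.eulerChar2 c = 0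

end FacePairing

namespace FacePairing

/-- Combinatorial isomorphism of face-pairings: a relabeling of the tetrahedra together with a
relabeling of the vertices of each tetrahedron carrying one pairing (and its gluing maps) to
the other. -/
def Iso {n : ℕ} (P Q : FacePairing n) : Prop :=
  ∃ (θ : Equiv.Perm (Fin n)) (ρ : Fin n → Equiv.Perm (Fin 4)),
    (∀ f : Fin n × Fin 4,
      Q.pair (θ f.1, ρ f.1 f.2) = (θ (P.pair f).1, ρ (P.pair f).1 (P.pair f).2)) ∧
    (∀ f : Fin n × Fin 4,
      Q.glue (θ f.1, ρ f.1 f.2) = (ρ f.1).symm.trans ((P.glue f).trans (ρ (P.pair f).1)))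

end FacePairing

/-- The class `M_{g,k}`: ideal triangulations with `g + k` tetrahedra of compact orientable
3-manifolds whose boundary is `Σ_g ⊔ (k tori)`.  (By uniqueness of the minimal ideal
triangulation of such manifolds, isomorphism classes of these triangulations correspond
bijectively to the manifolds themselves.) -/
def Mgk (g k : ℕ) := {P : FacePairing (g + k) // P.Oriented ∧ P.BoundaryIs g k}

/-- The number `N(g,k)` of compact orientable 3-manifolds admitting an ideal triangulation
with `g + k` tetrahedra and boundary `Σ_g ⊔ (k tori)`, counted as the number of isomorphism
classes of such triangulations. -/
noncomputable def N (g k : ℕ) : ℕ :=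
  Nat.card (Quot (fun P Q : Mgk g k => FacePairing.Iso P.1 Q.1))

/-- The building blocks of the triangulations.  Every block has two "wires", each of which has two
free faces; a core carries the long edges, a cusped block contains a torus cusp. -/
inductive Block
  | smallCore
  | largeCore
  | cusped
  | link
  deriving DecidableEq

namespace Block

instance : Fintype Block :=
  ⟨{smallCore, largeCore, cusped, link}, fun x => by cases x <;> decide⟩

/-- The odd permutations of four letters, in lexicographic order. -/
def oddFun : Fin 12 → Fin 4 → Fin 4 :=
  ![![0, 1, 3, 2], ![0, 2, 1, 3], ![0, 3, 2, 1], ![1, 0, 2, 3], ![1, 2, 3, 0], ![1, 3, 0, 2],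
    ![2, 0, 3, 1], ![2, 1, 0, 3], ![2, 3, 1, 0], ![3, 0, 1, 2], ![3, 1, 2, 0], ![3, 2, 0, 1]]

/-- The index of the inverse permutation. -/
def oddInv : Fin 12 → Fin 12 := ![0, 1, 2, 3, 9, 6, 5, 7, 11, 4, 10, 8]

/-- `oddFun` as a permutation. -/
def oddPerm (x : Fin 12) : Equiv.Perm (Fin 4) where
  toFun := oddFun x
  invFun := oddFun (oddInv x)
  left_inv := by revert x; decide
  right_inv := by revert x; decide

theorem sign_oddPerm : ∀ x, Equiv.Perm.sign (oddPerm x) = -1 := by decide +kernel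

theorem oddPerm_oddInv (x : Fin 12) : oddPerm (oddInv x) = (oddPerm x).symm := by
  ext i
  rfl

/-- The number of tetrahedra of a block. -/
def size : Block → ℕ
  | smallCore => 4
  | largeCore => 6
  | cusped => 7
  | link => 4

/-- The gluing of a block after closing up its two wires: entry `(t', x)` at position `t`, `i`
means that the face `i` of tetrahedron `t` is glued to tetrahedron `t'` via `oddPerm x`.  The
wires are the pairs of faces `(0, 0)`, `(1, 0)` and `(2, 0)`, `(3, 0)`.  The rows from `size` on
are irrelevant. -/
def table : Block → Fin 7 → Fin 4 → Fin 7 × Fin 12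
  | smallCore => ![![(1, 1), (2, 0), (3, 1), (1, 5)],
      ![(0, 1), (3, 4), (0, 6), (2, 5)],
      ![(3, 1), (0, 0), (1, 6), (3, 3)],
      ![(2, 1), (0, 1), (1, 9), (2, 3)],
      ![(4, 3), (4, 3), (4, 0), (4, 0)],
      ![(5, 3), (5, 3), (5, 0), (5, 0)],
      ![(6, 3), (6, 3), (6, 0), (6, 0)]]
  | largeCore => ![![(1, 1), (3, 4), (4, 8), (5, 6)],
      ![(0, 1), (5, 1), (2, 10), (4, 0)],
      ![(3, 1), (5, 6), (1, 10), (3, 7)],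
      ![(2, 1), (4, 9), (0, 9), (2, 7)],
      ![(3, 4), (0, 11), (1, 0), (5, 3)],
      ![(2, 5), (0, 5), (1, 1), (4, 3)],
      ![(6, 3), (6, 3), (6, 0), (6, 0)]]
  | cusped => ![![(1, 1), (4, 0), (4, 2), (4, 1)],
      ![(0, 1), (4, 6), (6, 9), (2, 7)],
      ![(3, 1), (3, 11), (5, 11), (1, 7)],
      ![(2, 1), (6, 8), (2, 8), (5, 9)],
      ![(1, 5), (0, 0), (0, 2), (0, 1)],
      ![(2, 8), (6, 6), (3, 4), (6, 9)],
      ![(5, 5), (1, 4), (5, 4), (3, 11)]]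
  | link => ![![(1, 1), (2, 11), (3, 9), (1, 7)],
      ![(0, 1), (3, 5), (2, 6), (0, 7)],
      ![(3, 1), (3, 11), (0, 8), (1, 5)],
      ![(2, 1), (0, 4), (2, 8), (1, 6)],
      ![(4, 3), (4, 3), (4, 0), (4, 0)],
      ![(5, 3), (5, 3), (5, 0), (5, 0)],
      ![(6, 3), (6, 3), (6, 0), (6, 0)]]

/-- The tetrahedron across the face `i` of `t`. -/
def nbr (u : Block) (t : Fin 7) (i : Fin 4) : Fin 7 := (table u t i).1

/-- The gluing map at the face `i` of `t`. -/
def glue (u : Block) (t : Fin 7) (i : Fin 4) : Equiv.Perm (Fin 4) := oddPerm (table u t i).2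

/-- The four free faces, at the ends of the wires. -/
def IsFree (t : Fin 7) (i : Fin 4) : Prop := i = 0 ∧ t < 4

instance (t : Fin 7) (i : Fin 4) : Decidable (IsFree t i) := inferInstanceAs (Decidable (_ ∧ _))

theorem nbr_nbr : ∀ u t i, nbr u (nbr u t i) (glue u t i i) = t := by decide +kernel

theorem glue_nbr (u t i) : glue u (nbr u t i) (glue u t i i) = (glue u t i).symm := by
  have h : ∀ u t i, (table u (nbr u t i) (glue u t i i)).2 = oddInv (table u t i).2 := by
    decide +kernel
  rw [glue, h, oddPerm_oddInv, glue]

theorem nbr_lt_size : ∀ u t i, t.val < size u → (nbr u t i).val < size u := by decide +kernel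

theorem lt_size_of_lt_four : ∀ u (t : Fin 7), t < 4 → t.val < size u := by decide +kernel

theorem table_eq_of_isFree : ∀ u u' t i, IsFree t i → table u t i = table u' t i := by
  decide +kernel

/-- A corner `(t, v, w)` of a block: the end at `v` of the edge `vw` of tetrahedron `t`. -/
abbrev BlockCorner := Fin 7 × Fin 4 × Fin 4

/-- The genuine corners of a block. -/
def Valid (u : Block) (c : BlockCorner) : Prop := c.1.val < size u ∧ c.2.1 ≠ c.2.2

instance (u : Block) (c : BlockCorner) : Decidable (Valid u c) :=
  inferInstanceAs (Decidable (_ ∧ _))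

/-- The corner reached by crossing the face `i`. -/
def across (u : Block) (i : Fin 4) (c : BlockCorner) : BlockCorner :=
  (nbr u c.1 i, glue u c.1 i c.2.1, glue u c.1 i c.2.2)

theorem Valid.across {u : Block} {c : BlockCorner} (h : Valid u c) (i : Fin 4) :
    Valid u (across u i c) :=
  ⟨nbr_lt_size u _ i h.1, fun he => h.2 ((glue u c.1 i).injective he)⟩

/-- The face `i` such that `v, w, i` are the first three letters of an even permutation. -/
def exitFace : Fin 4 → Fin 4 → Fin 4 :=
  ![![0, 2, 3, 1], ![3, 0, 0, 2], ![1, 3, 0, 0], ![2, 0, 1, 0]]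

theorem exitFace_ne : ∀ v w, v ≠ w → exitFace v w ≠ v ∧ exitFace v w ≠ w := by decide

/-- The next corner in positive direction around the link vertex. -/
def next (u : Block) (c : BlockCorner) : BlockCorner := across u (exitFace c.2.1 c.2.2) c

/-- The positive direction leads out of the block. -/
def Exits (c : BlockCorner) : Prop := IsFree c.1 (exitFace c.2.1 c.2.2)

instance (c : BlockCorner) : Decidable (Exits c) := inferInstanceAs (Decidable (IsFree _ _))

/-- Walk in positive direction until a corner satisfying `halt`. -/
def walk (u : Block) (halt : BlockCorner → Prop) [DecidablePred halt] :
    ℕ → BlockCorner → BlockCorner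
  | 0, c => c
  | k + 1, c => if halt c then c else walk u halt k (next u c)

/-- The blocks carrying the two long link vertices. -/
def IsCore (u : Block) : Prop := u = smallCore ∨ u = largeCore

instance (u : Block) : Decidable (IsCore u) := inferInstanceAs (Decidable (_ ∨ _))

/-- The two link vertices coming from the core, and the two link vertices inside a cusped
block, the last one being the vertex of the torus. -/
def rep : Fin 4 → BlockCorner := ![(0, 0, 1), (0, 0, 2), (0, 1, 0), (0, 0, 1)]

/-- The corners where walks in a block halt. -/
def Halts (u : Block) (c : BlockCorner) : Prop :=
  if IsCore u then c = rep 0 ∨ c = rep 1 else Exits c ∨ (u = cusped ∧ (c = rep 2 ∨ c = rep 3))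

instance (u : Block) : DecidablePred (Halts u) := fun c =>
  inferInstanceAs (Decidable (if IsCore u then c = rep 0 ∨ c = rep 1
    else Exits c ∨ (u = cusped ∧ (c = rep 2 ∨ c = rep 3))))

/-- The corners where walks end. -/
def endCorner : Fin 15 → BlockCorner :=
  ![(0, 1, 2), (0, 2, 3), (0, 3, 1), (1, 1, 2), (1, 2, 3), (1, 3, 1), (2, 1, 2), (2, 2, 3),
    (2, 3, 1), (3, 1, 2), (3, 2, 3), (3, 3, 1), (0, 0, 1), (0, 0, 2), (0, 1, 0)]

/-- The index of the end of the walk from a corner. -/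
def endTable : Block → Fin 7 → Fin 4 → Fin 4 → Fin 15
  | smallCore => ![![![0, 12, 13, 13], ![13, 0, 13, 12], ![12, 12, 0, 12], ![12, 13, 13, 0]],
      ![![0, 12, 13, 12], ![13, 0, 12, 12], ![12, 13, 0, 12], ![13, 13, 13, 0]],
      ![![0, 12, 13, 13], ![13, 0, 12, 12], ![12, 13, 0, 13], ![12, 13, 12, 0]],
      ![![0, 13, 12, 13], ![12, 0, 13, 13], ![13, 12, 0, 12], ![12, 12, 13, 0]],
      ![![0, 0, 0, 0], ![0, 0, 0, 0], ![0, 0, 0, 0], ![0, 0, 0, 0]],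
      ![![0, 0, 0, 0], ![0, 0, 0, 0], ![0, 0, 0, 0], ![0, 0, 0, 0]],
      ![![0, 0, 0, 0], ![0, 0, 0, 0], ![0, 0, 0, 0], ![0, 0, 0, 0]]]
  | largeCore => ![![![0, 12, 13, 13], ![13, 0, 12, 12], ![12, 13, 0, 12], ![12, 13, 13, 0]],
      ![![0, 12, 13, 12], ![13, 0, 13, 12], ![12, 12, 0, 12], ![13, 13, 13, 0]],
      ![![0, 13, 13, 13], ![12, 0, 13, 13], ![12, 12, 0, 13], ![12, 12, 12, 0]],
      ![![0, 12, 12, 13], ![13, 0, 12, 13], ![13, 13, 0, 13], ![12, 12, 12, 0]],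
      ![![0, 12, 12, 13], ![13, 0, 13, 13], ![13, 12, 0, 12], ![12, 12, 13, 0]],
      ![![0, 13, 13, 12], ![12, 0, 12, 12], ![12, 13, 0, 13], ![13, 13, 12, 0]],
      ![![0, 0, 0, 0], ![0, 0, 0, 0], ![0, 0, 0, 0], ![0, 0, 0, 0]]]
  | cusped => ![![![0, 12, 12, 12], ![14, 0, 0, 4], ![14, 3, 0, 1], ![14, 2, 5, 0]],
      ![![0, 9, 5, 0], ![6, 0, 3, 1], ![1, 0, 0, 4], ![3, 5, 2, 0]],
      ![![0, 0, 1, 11], ![3, 0, 6, 10], ![5, 9, 0, 7], ![7, 8, 11, 0]],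
      ![![0, 7, 11, 5], ![11, 0, 9, 7], ![7, 6, 0, 10], ![1, 11, 8, 0]],
      ![![0, 12, 12, 12], ![14, 0, 3, 2], ![14, 0, 0, 5], ![14, 4, 1, 0]],
      ![![0, 9, 3, 11], ![6, 0, 8, 7], ![0, 10, 0, 3], ![7, 11, 0, 0]],
      ![![0, 8, 1, 6], ![10, 0, 7, 0], ![5, 11, 0, 3], ![9, 3, 0, 0]]]
  | link => ![![![0, 0, 7, 8], ![3, 0, 0, 4], ![11, 3, 0, 1], ![10, 2, 5, 0]],
      ![![0, 3, 11, 9], ![0, 0, 3, 1], ![7, 0, 0, 4], ![6, 5, 2, 0]],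
      ![![0, 1, 0, 11], ![5, 0, 6, 10], ![3, 9, 0, 7], ![7, 8, 11, 0]],
      ![![0, 7, 4, 3], ![11, 0, 9, 7], ![2, 6, 0, 10], ![0, 11, 8, 0]],
      ![![0, 0, 0, 0], ![0, 0, 0, 0], ![0, 0, 0, 0], ![0, 0, 0, 0]],
      ![![0, 0, 0, 0], ![0, 0, 0, 0], ![0, 0, 0, 0], ![0, 0, 0, 0]],
      ![![0, 0, 0, 0], ![0, 0, 0, 0], ![0, 0, 0, 0], ![0, 0, 0, 0]]]

/-- The end of the walk from a corner. -/
def finish (u : Block) (c : BlockCorner) : BlockCorner :=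
  endCorner (endTable u c.1 c.2.1 c.2.2)

theorem walk_eq_finish : ∀ u c, Valid u c → walk u (Halts u) 40 c = finish u c := by
  decide +kernel

theorem halts_finish : ∀ u c, Valid u c → Halts u (finish u c) := by decide +kernel

theorem finish_next : ∀ u c, ¬ IsCore u → Valid u c → Exits c → finish u (next u c) = c := by
  decide +kernel

/-- The link vertex at a corner, given the core `r`. -/
def label (r u : Block) (c : BlockCorner) : Fin 4 :=
  if IsCore u then if finish u c = rep 0 then 0 else 1
  else if Exits (finish u c) then if finish r (finish u c) = rep 0 then 0 else 1
  else if finish u c = rep 2 then 2 else 3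

theorem label_across : ∀ r u c i, IsCore r → (IsCore u → u = r) → Valid u c → i ≠ c.2.1 →
    i ≠ c.2.2 → ¬ IsFree c.1 i → label r u (across u i c) = label r u c := by
  decide +kernel

theorem label_across_of_isFree {r u u' : Block} {c : BlockCorner} {i : Fin 4} (hr : IsCore r)
    (hu : IsCore u → u = r) (hu' : IsCore u' → u' = r) (hc : Valid u c) (hv : i ≠ c.2.1)
    (hw : i ≠ c.2.2) (hi : IsFree c.1 i) :
    label r u' (across u i c) = label r u c ∧ label r u c < 2 := by
  have key : ∀ r, IsCore r → ∀ u, (IsCore u → u = r) → ∀ c : BlockCorner, c.1 < 4 →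
      c.2.1 ≠ c.2.2 → 0 ≠ c.2.1 → 0 ≠ c.2.2 →
      label r u c = label r r c ∧ label r u (across r 0 c) = label r r c ∧ label r r c < 2 := by
    decide +kernel
  obtain ⟨rfl, ht⟩ := hi
  have h : across u 0 c = across r 0 c := by
    simp only [across, nbr, glue, table_eq_of_isFree u r c.1 0 ⟨rfl, ht⟩]
  obtain ⟨h₁, -, h₃⟩ := key r hr u hu c ht hc.2 hv hw
  obtain ⟨-, h₂, -⟩ := key r hr u' hu' c ht hc.2 hv hw
  rw [h, h₁, h₂]
  exact ⟨rfl, h₃⟩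

/-- The two vertices of a cusped block at the torus. -/
def AtCusp (u : Block) (t : Fin 7) (v : Fin 4) : Prop := u = cusped ∧ v = 0 ∧ (t = 0 ∨ t = 4)

instance (u : Block) (t : Fin 7) (v : Fin 4) : Decidable (AtCusp u t v) :=
  inferInstanceAs (Decidable (_ ∧ _))

theorem label_eq_three_iff : ∀ r u c, IsCore r → (IsCore u → u = r) → Valid u c →
    (label r u c = 3 ↔ AtCusp u c.1 c.2.1) := by
  decide +kernel

theorem exists_label_ne_two : ∀ r u (t : Fin 7) (v : Fin 4), IsCore r → (IsCore u → u = r) →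
    t.val < size u → ∃ w, v ≠ w ∧ label r u (t, v, w) ≠ 2 := by
  decide +kernel

theorem exists_iterate_nbr_eq_zero : ∀ u (t : Fin 7), t.val < size u →
    ∃ k : Fin 7, (fun x => nbr u x 1)^[k] t = 0 := by
  decide +kernel

end Block

namespace Block

theorem eq_of_exits : ∀ u u' c, Exits c → next u c = next u' c := by decide +kernel

theorem valid_of_exits : ∀ u c, c.2.1 ≠ c.2.2 → Exits c → Valid u c := by decide +kernel

theorem nbr_ne : ∀ u t i, nbr u t i = t → glue u t i i ≠ i := by decide +kernel

theorem valid_rep : ∀ u l, Valid u (rep l) := by decide +kernel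

theorem label_rep : ∀ r u l, IsCore r → (l < 2 → u = r) → (2 ≤ l → u = cusped) →
    label r u (rep l) = l := by decide +kernel

theorem cusped_of_two_le_label : ∀ r u c, IsCore r → (IsCore u → u = r) → Valid u c →
    2 ≤ label r u c → u = cusped := by decide +kernel

/-- The wire end at the face `i` of the tetrahedron `t`, or `0` if the face is not free. -/
def wireEnd (t : Fin 7) (i : Fin 4) : Fin 5 := if i = 0 then ![1, 2, 3, 4, 0, 0, 0] t else 0

theorem wireEnd_nbr : ∀ u t i,
    wireEnd (nbr u t i) (glue u t i i) = (![0, 2, 1, 4, 3] : Fin 5 → Fin 5) (wireEnd t i) := by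
  decide +kernel

theorem wireEnd_eq_zero : ∀ t i, ¬ IsFree t i → wireEnd t i = 0 := by decide +kernel

theorem nbr_lt_four : ∀ u t i, IsFree t i → nbr u t i < 4 := by decide +kernel

theorem isFree_nbr_iff : ∀ u t i, IsFree (nbr u t i) (glue u t i i) ↔ IsFree t i := by
  decide +kernel

end Block

open Block

/-- A pattern for assembling blocks indexed by `J`: exactly one of the blocks is a core, and the
two wires run through all blocks in the cyclic orders `succ false` and `succ true`. -/
structure Wiring (J : Type) where
  kind : J → Block
  root : J
  succ : Bool → Equiv.Perm J
  isCore_root : IsCore (kind root)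
  eq_root : ∀ j, IsCore (kind j) → j = root
  sameCycle : ∀ b j, (succ b).SameCycle root j

namespace Wiring

variable {J : Type} (W : Wiring J)

/-- The tetrahedra of the assembled triangulation. -/
abbrev Tet := {x : J × Fin 7 // x.2.val < size (W.kind x.1)}

/-- The permutation of the blocks describing the motion across the face `i` of the tetrahedra of
index `t`. -/
def hop (t : Fin 7) (i : Fin 4) : Equiv.Perm J :=
  (![1, (W.succ false)⁻¹, W.succ false, (W.succ true)⁻¹, W.succ true] : Fin 5 → Equiv.Perm J)
    (wireEnd t i)

theorem hop_nbr (u : Block) (t : Fin 7) (i : Fin 4) :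
    W.hop (nbr u t i) (glue u t i i) = (W.hop t i)⁻¹ := by
  rw [hop, hop, wireEnd_nbr]
  generalize wireEnd t i = x
  fin_cases x <;> simp

theorem hop_of_not_isFree {t : Fin 7} {i : Fin 4} (h : ¬ IsFree t i) : W.hop t i = 1 := by
  simp [hop, wireEnd_eq_zero t i h]

theorem sameCycle_hop {t : Fin 7} {i : Fin 4} (h : IsFree t i) (j : J) :
    (W.hop t i).SameCycle W.root j := by
  have key : ∀ t i, IsFree t i → wireEnd t i ≠ 0 := by decide +kernel
  have h' := key t i h
  rw [hop]
  generalize wireEnd t i = x at h'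
  fin_cases x
  · simp at h'
  · exact Equiv.Perm.sameCycle_inv.2 (W.sameCycle false j)
  · exact W.sameCycle false j
  · exact Equiv.Perm.sameCycle_inv.2 (W.sameCycle true j)
  · exact W.sameCycle true j

theorem nbr_lt_size_hop (j : J) (t : Fin 7) (i : Fin 4) (h : t.val < size (W.kind j)) :
    (nbr (W.kind j) t i).val < size (W.kind (W.hop t i j)) := by
  by_cases hi : IsFree t i
  · exact lt_size_of_lt_four _ _ (nbr_lt_four _ t i hi)
  · rw [W.hop_of_not_isFree hi]
    exact nbr_lt_size _ _ _ h

theorem table_hop_eq (j : J) (t : Fin 7) (i : Fin 4) :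
    table (W.kind (W.hop t i j)) (nbr (W.kind j) t i) (glue (W.kind j) t i i) =
      table (W.kind j) (nbr (W.kind j) t i) (glue (W.kind j) t i i) := by
  by_cases hi : IsFree t i
  · exact table_eq_of_isFree _ _ _ _ ((isFree_nbr_iff _ t i).2 hi)
  · rw [W.hop_of_not_isFree hi]
    rfl

/-- The tetrahedron across the face `i` of `x`. -/
def adj (x : W.Tet) (i : Fin 4) : W.Tet :=
  ⟨(W.hop x.1.2 i x.1.1, nbr (W.kind x.1.1) x.1.2 i), W.nbr_lt_size_hop _ _ _ x.2⟩

/-- The gluing map at the face `i` of `x`. -/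
def glueAt (x : W.Tet) (i : Fin 4) : Equiv.Perm (Fin 4) := glue (W.kind x.1.1) x.1.2 i

theorem adj_adj (x : W.Tet) (i : Fin 4) : W.adj (W.adj x i) (W.glueAt x i i) = x := by
  obtain ⟨⟨j, t⟩, h⟩ := x
  apply Subtype.ext
  refine Prod.ext ?_ ?_
  · change W.hop (nbr (W.kind j) t i) (glue (W.kind j) t i i) (W.hop t i j) = j
    rw [hop_nbr]
    exact (W.hop t i).symm_apply_apply j
  · have := nbr_nbr (W.kind j) t i
    rw [nbr, ← table_hop_eq] at this
    exact this

theorem glueAt_adj (x : W.Tet) (i : Fin 4) :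
    W.glueAt (W.adj x i) (W.glueAt x i i) = (W.glueAt x i).symm := by
  obtain ⟨⟨j, t⟩, h⟩ := x
  have := glue_nbr (W.kind j) t i
  rw [glue, ← table_hop_eq] at this
  exact this

variable {n : ℕ} (e : W.Tet ≃ Fin n)

/-- The face glued to a given face, when the tetrahedra are numbered by `e`. -/
def partner (f : Fin n × Fin 4) : Fin n × Fin 4 :=
  (e (W.adj (e.symm f.1) f.2), W.glueAt (e.symm f.1) f.2 f.2)

theorem partner_involutive : Function.Involutive (W.partner e) := fun f => by
  simp only [partner, Equiv.symm_apply_apply, adj_adj, glueAt_adj, Equiv.apply_symm_apply]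

/-- The triangulation assembled from the blocks, with tetrahedra numbered by `e`. -/
def facePairing : FacePairing n where
  pair := (W.partner_involutive e).toPerm
  pair_invol f := W.partner_involutive e f
  pair_ne f h := by
    have h₁ := congrArg (fun y => (e.symm y.1).1.2) h
    have h₂ := congrArg Prod.snd h
    simp only [Function.Involutive.coe_toPerm, partner, Equiv.symm_apply_apply] at h₁ h₂
    exact nbr_ne _ _ _ h₁ h₂
  glue f := W.glueAt (e.symm f.1) f.2
  glue_vertex f := rfl
  glue_compat f := by
    simp only [Function.Involutive.coe_toPerm, partner, Equiv.symm_apply_apply, glueAt_adj]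

theorem facePairing_pair (x : W.Tet) (i : Fin 4) :
    (W.facePairing e).pair (e x, i) = (e (W.adj x i), W.glueAt x i i) := by
  simp [facePairing, partner]

theorem facePairing_glue (x : W.Tet) (i : Fin 4) :
    (W.facePairing e).glue (e x, i) = W.glueAt x i := by
  simp [facePairing]

theorem facePairing_oriented : (W.facePairing e).Oriented := fun _ => sign_oddPerm _

/-- The corner `c` of the block `j`. -/
def corner (j : J) (c : BlockCorner) (h : Valid (W.kind j) c) : FacePairing.Corner n :=
  ⟨(e ⟨(j, c.1), h.1⟩, c.2), h.2⟩

/-- The link vertex at the corner `c` of the block `j`, if this corner exists. -/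
def linkClass (j : J) (c : BlockCorner) : Option (W.facePairing e).LinkVertexClass :=
  if h : Valid (W.kind j) c then some (Quot.mk _ (W.corner e j c h)) else none

variable {W}

theorem linkClass_across {j : J} {c : BlockCorner} (h : Valid (W.kind j) c) {i : Fin 4}
    (hv : i ≠ c.2.1) (hw : i ≠ c.2.2) :
    W.linkClass e (W.hop c.1 i j) (across (W.kind j) i c) = W.linkClass e j c := by
  have h' : Valid (W.kind (W.hop c.1 i j)) (across (W.kind j) i c) :=
    ⟨W.nbr_lt_size_hop _ _ _ h.1, (h.across i).2⟩
  rw [linkClass, linkClass, dif_pos h, dif_pos h']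
  refine congrArg some (Quot.sound ⟨i, hv, hw, ?_⟩).symm
  simp only [corner, facePairing_pair, facePairing_glue]
  rfl

theorem linkClass_walk {j : J} (halt : BlockCorner → Prop) [DecidablePred halt]
    (hs : ∀ c, Valid (W.kind j) c → ¬ halt c →
      W.linkClass e j (next (W.kind j) c) = W.linkClass e j c) (m : ℕ) :
    ∀ c, Valid (W.kind j) c → W.linkClass e j (walk (W.kind j) halt m c) = W.linkClass e j c := by
  induction m with
  | zero => intro c _; rfl
  | succ m ih =>
    intro c hc
    rw [walk]
    split_ifs with h
    · rfl
    · rw [next, ih _ (hc.across _)]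
      exact hs c hc h

theorem linkClass_next_of_not_exits {j : J} {c : BlockCorner} (hc : Valid (W.kind j) c)
    (h : ¬ Exits c) : W.linkClass e j (next (W.kind j) c) = W.linkClass e j c := by
  have := exitFace_ne _ _ hc.2
  rw [← linkClass_across e hc this.1 this.2, W.hop_of_not_isFree h]
  rfl

theorem linkClass_next_of_not_isCore {j : J} {c : BlockCorner} (hc : Valid (W.kind j) c)
    (hj : ¬ IsCore (W.kind j)) : W.linkClass e j (next (W.kind j) c) = W.linkClass e j c := by
  by_cases h : Exits c
  · conv_rhs => rw [← finish_next _ c hj hc h]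
    rw [← walk_eq_finish _ (next _ c) (hc.across _)]
    refine (linkClass_walk e _ (fun c' hc' hs => linkClass_next_of_not_exits e hc' ?_) _ _
      (hc.across _)).symm
    rw [Halts, if_neg hj] at hs
    exact fun hx => hs (Or.inl hx)
  · exact linkClass_next_of_not_exits e hc h

theorem linkClass_eq_root_of_exits [Finite J] (j : J) {c : BlockCorner} (hc : c.2.1 ≠ c.2.2)
    (h : Exits c) : W.linkClass e j c = W.linkClass e W.root c := by
  obtain ⟨m, rfl⟩ := (W.sameCycle_hop h j).exists_nat_pow_eq
  induction m with
  | zero => rfl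
  | succ m ih =>
    by_cases hr : (W.hop c.1 (exitFace c.2.1 c.2.2) ^ (m + 1)) W.root = W.root
    · rw [hr]
    · rw [← ih]
      have hx := exitFace_ne _ _ hc
      rw [← linkClass_next_of_not_isCore e (valid_of_exits _ c hc h)
          (fun hcore => hr (W.eq_root _ hcore)), pow_succ', Equiv.Perm.mul_apply,
        ← linkClass_across e (j := (W.hop c.1 (exitFace c.2.1 c.2.2) ^ m) W.root)
          (valid_of_exits _ c hc h) hx.1 hx.2]
      exact congrArg _ (eq_of_exits _ _ _ h)

theorem linkClass_next [Finite J] {j : J} {c : BlockCorner} (hc : Valid (W.kind j) c) :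
    W.linkClass e j (next (W.kind j) c) = W.linkClass e j c := by
  by_cases h : Exits c
  · have hx := exitFace_ne _ _ hc.2
    set π := W.hop c.1 (exitFace c.2.1 c.2.2)
    have h₁ := linkClass_across e (valid_of_exits (W.kind (π⁻¹ j)) c hc.2 h) hx.1 hx.2
    rw [linkClass_eq_root_of_exits e _ hc.2 h, ← linkClass_eq_root_of_exits e j hc.2 h,
      show W.hop c.1 (exitFace c.2.1 c.2.2) (π⁻¹ j) = j from π.apply_symm_apply j] at h₁
    rw [← h₁]
    exact congrArg _ (eq_of_exits _ _ _ h)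
  · exact linkClass_next_of_not_exits e hc h

theorem linkClass_finish [Finite J] {j : J} {c : BlockCorner} (hc : Valid (W.kind j) c) :
    W.linkClass e j (finish (W.kind j) c) = W.linkClass e j c := by
  rw [← walk_eq_finish _ _ hc]
  exact linkClass_walk e _ (fun _ hc _ => linkClass_next e hc) _ _ hc

variable (W) in
/-- The name of the link vertex at the corner `c` of the block `j`: the label of the corner,
together with the block when the link vertex is contained in it. -/
def linkKey (j : J) (c : BlockCorner) : J × Fin 4 :=
  (if label (W.kind W.root) (W.kind j) c < 2 then W.root else j,
    label (W.kind W.root) (W.kind j) c)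

theorem isCore_imp (j : J) (h : IsCore (W.kind j)) : W.kind j = W.kind W.root := by
  rw [W.eq_root j h]

theorem linkClass_eq_linkKey [Finite J] {j : J} {c : BlockCorner} (hc : Valid (W.kind j) c) :
    W.linkClass e j c = W.linkClass e (W.linkKey j c).1 (rep (W.linkKey j c).2) := by
  have hcore : ∀ c, Valid (W.kind W.root) c → W.linkClass e W.root c =
      W.linkClass e W.root (rep (if finish (W.kind W.root) c = rep 0 then 0 else 1)) := by
    intro c hc
    rw [← linkClass_finish e hc]
    have := halts_finish _ c hc
    rw [Halts, if_pos W.isCore_root] at this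
    split_ifs with h
    · rw [h]
    · rw [this.resolve_left h]
  by_cases hj : IsCore (W.kind j)
  · obtain rfl := W.eq_root j hj
    rw [hcore c hc]
    simp [linkKey, label, hj]
  · have hs := halts_finish _ c hc
    rw [Halts, if_neg hj] at hs
    rw [← linkClass_finish e hc]
    by_cases hx : Exits (finish (W.kind j) c)
    · have hne : (finish (W.kind j) c).2.1 ≠ (finish (W.kind j) c).2.2 := by
        have key : ∀ u c, Valid u c → (finish u c).2.1 ≠ (finish u c).2.2 := by decide +kernel
        exact key _ c hc
      rw [linkClass_eq_root_of_exits e j hne hx, hcore _ (valid_of_exits _ _ hne hx)]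
      have : label (W.kind W.root) (W.kind j) c =
          if finish (W.kind W.root) (finish (W.kind j) c) = rep 0 then 0 else 1 := by
        simp [label, hj, hx]
      have hlt : label (W.kind W.root) (W.kind j) c < 2 := by
        rw [this]; split_ifs <;> decide
      rw [linkKey, if_pos hlt, this]
    · by_cases h2 : finish (W.kind j) c = rep 2
      · have : label (W.kind W.root) (W.kind j) c = 2 := by
          simp [label, hj, h2]
          intro h; rw [h2] at hx; exact absurd h hx
        simp [linkKey, this, h2]
      · have : label (W.kind W.root) (W.kind j) c = 3 := by
          simp [label, hj, h2, hx]
        have h3 := ((hs.resolve_left hx).2).resolve_left h2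
        simp [linkKey, this, h3]

end Wiring

namespace Wiring

variable {J : Type} {W : Wiring J} {n : ℕ} (e : W.Tet ≃ Fin n)

theorem linkKey_across {j : J} {c : BlockCorner} (h : Valid (W.kind j) c) {i : Fin 4}
    (hv : i ≠ c.2.1) (hw : i ≠ c.2.2) :
    W.linkKey (W.hop c.1 i j) (across (W.kind j) i c) = W.linkKey j c := by
  by_cases hi : IsFree c.1 i
  · have := label_across_of_isFree W.isCore_root (isCore_imp j)
      (isCore_imp (W.hop c.1 i j)) h hv hw hi
    simp only [linkKey, this.1, this.2, if_true]
  · simp only [linkKey, W.hop_of_not_isFree hi, Equiv.Perm.one_apply,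
      label_across _ _ c i W.isCore_root (isCore_imp j) h hv hw hi]

/-- The name of the link vertex at a corner. -/
def cornerKey (a : FacePairing.Corner n) : J × Fin 4 :=
  W.linkKey (e.symm a.1.1).1.1 ((e.symm a.1.1).1.2, a.1.2)

theorem cornerKey_corner (j : J) (c : BlockCorner) (h : Valid (W.kind j) c) :
    cornerKey e (W.corner e j c h) = W.linkKey j c := by
  simp [cornerKey, corner]

theorem exists_corner (a : FacePairing.Corner n) : ∃ j c h, a = W.corner e j c h :=
  ⟨(e.symm a.1.1).1.1, ((e.symm a.1.1).1.2, a.1.2), ⟨(e.symm a.1.1).2, a.2⟩,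
    Subtype.ext (by simp [corner])⟩

/-- The name of a link vertex. -/
def linkName : (W.facePairing e).LinkVertexClass → J × Fin 4 :=
  Quot.lift (cornerKey e) (by
    rintro a b ⟨i, hv, hw, hb⟩
    obtain ⟨j, c, h, rfl⟩ := exists_corner e a
    rw [cornerKey_corner, ← linkKey_across h hv hw]
    simp only [corner, facePairing_pair, facePairing_glue] at hb
    simp only [cornerKey, hb, Equiv.symm_apply_apply]
    rfl)

theorem linkName_mk_corner (j : J) (c : BlockCorner) (h : Valid (W.kind j) c) :
    linkName e (Quot.mk _ (W.corner e j c h)) = W.linkKey j c :=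
  cornerKey_corner e j c h

theorem mk_corner_eq_rep [Finite J] (j : J) (c : BlockCorner) (h : Valid (W.kind j) c) :
    (Quot.mk _ (W.corner e j c h) : (W.facePairing e).LinkVertexClass) =
      Quot.mk _ (W.corner e (W.linkKey j c).1 (rep (W.linkKey j c).2) (valid_rep _ _)) := by
  have := linkClass_eq_linkKey e h
  rw [linkClass, linkClass, dif_pos h, dif_pos (valid_rep _ _)] at this
  exact Option.some.inj this

theorem eq_mk_rep [Finite J] (l : (W.facePairing e).LinkVertexClass) :
    l = Quot.mk _ (W.corner e (linkName e l).1 (rep (linkName e l).2) (valid_rep _ _)) := by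
  induction l using Quot.ind with
  | mk a =>
    obtain ⟨j, c, h, rfl⟩ := exists_corner e a
    simp only [linkName_mk_corner]
    exact mk_corner_eq_rep e j c h

theorem linkName_injective [Finite J] : Function.Injective (linkName e) := fun l l' h => by
  have key : ∀ x y : J × Fin 4, x = y →
      (Quot.mk _ (W.corner e x.1 (rep x.2) (valid_rep _ _)) :
        (W.facePairing e).LinkVertexClass) =
      Quot.mk _ (W.corner e y.1 (rep y.2) (valid_rep _ _)) := by
    rintro x y rfl; rfl
  rw [eq_mk_rep e l, eq_mk_rep e l']
  exact key _ _ h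

theorem mem_range_linkName (x : J × Fin 4) : x ∈ Set.range (linkName e) ↔
    (x.2 < 2 → x.1 = W.root) ∧ (2 ≤ x.2 → W.kind x.1 = cusped) := by
  constructor
  · rintro ⟨l, rfl⟩
    induction l using Quot.ind with
    | mk a =>
      obtain ⟨j, c, h, rfl⟩ := exists_corner e a
      rw [linkName_mk_corner, linkKey]
      refine ⟨fun h => if_pos h, fun h' => ?_⟩
      simp only at h' ⊢
      rw [if_neg (not_lt.2 h')]
      exact cusped_of_two_le_label _ _ c W.isCore_root (isCore_imp j) h h'
  · rintro ⟨h₁, h₂⟩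
    refine ⟨Quot.mk _ (W.corner e x.1 (rep x.2) (valid_rep _ _)), ?_⟩
    have := label_rep (W.kind W.root) (W.kind x.1) x.2 W.isCore_root
      (fun h => by rw [h₁ h]) h₂
    rw [linkName_mk_corner, linkKey, this]
    refine Prod.ext ?_ rfl
    simp only
    split_ifs with h
    · exact (h₁ h).symm
    · rfl

/-- The block containing the torus at a vertex, or `none` for the big boundary component. -/
def cuspAt (a : Fin n × Fin 4) : Option J :=
  if AtCusp (W.kind (e.symm a.1).1.1) (e.symm a.1).1.2 a.2 then some (e.symm a.1).1.1 else none

/-- The boundary component carrying the link vertex with a given name. -/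
def cuspOf (x : J × Fin 4) : Option J := if x.2 = 3 then some x.1 else none

theorem cuspAt_eq_cuspOf (a : FacePairing.Corner n) :
    cuspAt e (a.1.1, a.1.2.1) = cuspOf (cornerKey e a) := by
  obtain ⟨j, c, h, rfl⟩ := exists_corner e a
  have := label_eq_three_iff _ _ c W.isCore_root (isCore_imp j) h
  rw [cornerKey_corner, cuspOf, linkKey]
  simp only [cuspAt, corner, Equiv.symm_apply_apply, ← this]
  split_ifs with h₁ h₂ <;> simp_all

/-- The block containing the torus, or `none` for the big boundary component. -/
def cuspName : (W.facePairing e).VertexClass → Option J :=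
  Quot.lift (cuspAt e) (by
    rintro ⟨x, v⟩ b ⟨i, hi, rfl⟩
    obtain ⟨w, hv, hw⟩ : ∃ w, v ≠ w ∧ i ≠ w := by
      clear hi; revert v i; decide
    have hab := congrArg (linkName e) (Quot.sound (r := (W.facePairing e).crel)
      (a := ⟨(x, v, w), hv⟩)
      (b := ⟨(((W.facePairing e).pair (x, i)).1, (W.facePairing e).glue (x, i) v,
        (W.facePairing e).glue (x, i) w), fun h => hv (Equiv.injective _ h)⟩)
      ⟨i, hi, hw, rfl⟩)
    exact (cuspAt_eq_cuspOf e ⟨(x, v, w), hv⟩).trans ((congrArg cuspOf hab).trans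
      (cuspAt_eq_cuspOf e ⟨(((W.facePairing e).pair (x, i)).1, (W.facePairing e).glue (x, i) v,
        (W.facePairing e).glue (x, i) w), fun h => hv (Equiv.injective _ h)⟩).symm))

/-- The boundary component containing a link vertex. -/
def component : (W.facePairing e).LinkVertexClass → (W.facePairing e).VertexClass :=
  Quot.lift (fun a => Quot.mk _ (a.1.1, a.1.2.1)) (by
    rintro a b ⟨i, hv, -, hb⟩
    exact Quot.sound ⟨i, hv, by simp [hb]⟩)

theorem cuspName_component (l : (W.facePairing e).LinkVertexClass) :
    cuspName e (component e l) = cuspOf (linkName e l) := by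
  induction l using Quot.ind with
  | mk a => exact cuspAt_eq_cuspOf e a

/-- The boundary component at the first vertex of the block `j`. -/
def apex (j : J) : (W.facePairing e).VertexClass :=
  Quot.mk _ (e ⟨(j, 0), lt_size_of_lt_four _ 0 (by decide)⟩, 0)

theorem eq_apex [Finite J] (c : (W.facePairing e).VertexClass) :
    c = apex e ((cuspName e c).getD W.root) := by
  obtain ⟨l, rfl, hl⟩ : ∃ l, component e l = c ∧ (linkName e l).2 ≠ 2 := by
    induction c using Quot.ind with
    | mk a =>
      obtain ⟨x, v⟩ := a
      obtain ⟨⟨⟨j, t⟩, h⟩, rfl⟩ := e.surjective x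
      obtain ⟨w, hw, hl⟩ := exists_label_ne_two _ _ t v W.isCore_root (isCore_imp j) h
      have hc : Valid (W.kind j) (t, v, w) := ⟨h, hw⟩
      refine ⟨Quot.mk _ (W.corner e j (t, v, w) hc), rfl, ?_⟩
      rw [linkName_mk_corner]
      exact hl
  have hr := (mem_range_linkName e _).1 ⟨l, rfl⟩
  rw [cuspName_component]
  conv_lhs => rw [eq_mk_rep e l]
  generalize linkName e l = x at hl hr
  obtain ⟨j, m⟩ := x
  have hm : (rep m).1 = 0 ∧ (rep m).2.1 = 0 := by
    change m ≠ 2 at hl; clear hr; revert m; decide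
  have hj : (cuspOf (j, m)).getD W.root = j := by
    rw [cuspOf]
    split_ifs with h
    · rfl
    · exact (hr.1 (by simp only at hl h ⊢; omega)).symm
  rw [hj]
  simp only [component, corner, apex, hm]
  rfl

theorem cuspName_injective [Finite J] : Function.Injective (cuspName e) := fun c c' h => by
  rw [eq_apex e c, eq_apex e c', h]

theorem cuspName_apex (j : J) :
    cuspName e (apex e j) = if W.kind j = cusped then some j else none := by
  change cuspAt e _ = _
  simp [cuspAt, AtCusp]

theorem kind_eq_cusped_of_cuspName {c : (W.facePairing e).VertexClass} {j : J}
    (h : cuspName e c = some j) : W.kind j = cusped := by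
  induction c using Quot.ind with
  | mk a =>
    change cuspAt e a = _ at h
    rw [cuspAt] at h
    split_ifs at h with hc
    rw [← Option.some.inj h]
    exact hc.1

theorem range_cuspName :
    Set.range (cuspName e) = insert none (some '' {j | W.kind j = cusped}) := by
  ext x
  constructor
  · rintro ⟨c, rfl⟩
    cases h : cuspName e c with
    | none => exact Or.inl rfl
    | some j => exact Or.inr ⟨j, kind_eq_cusped_of_cuspName e h, rfl⟩
  · rintro (rfl | ⟨j, hj, rfl⟩)
    · refine ⟨apex e W.root, ?_⟩
      rw [cuspName_apex, if_neg]
      intro h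
      have := W.isCore_root
      rw [h] at this
      exact absurd this (by decide)
    · exact ⟨apex e j, by rw [cuspName_apex]; exact if_pos hj⟩

theorem card_vertexClass [Finite J] :
    Nat.card (W.facePairing e).VertexClass = 1 + {j | W.kind j = cusped}.ncard := by
  rw [← Set.ncard_univ, ← Set.ncard_image_of_injective _ (cuspName_injective e),
    Set.image_univ, range_cuspName, Set.ncard_insert_of_notMem (by simp),
    Set.ncard_image_of_injective _ (Option.some_injective _), add_comm]

theorem linkVertices_eq [Finite J] (c : (W.facePairing e).VertexClass) :
    (W.facePairing e).linkVertices c =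
      (Set.range (linkName e) ∩ {x | cuspOf x = cuspName e c}).ncard := by
  rw [← Set.image_preimage_eq_range_inter, Set.ncard_image_of_injective _ (linkName_injective e)]
  change Nat.card _ = Nat.card _
  refine Nat.card_congr (Equiv.subtypeEquivRight fun l => ?_)
  rw [Set.mem_preimage, Set.mem_ofPred_eq, ← cuspName_component,
    (cuspName_injective e).eq_iff]
  constructor
  · rintro ⟨a, rfl, h⟩
    exact h
  · intro h
    obtain ⟨a, rfl⟩ := Quot.exists_rep l
    exact ⟨a, rfl, h⟩

theorem linkTriangles_eq [Finite J] (c : (W.facePairing e).VertexClass) :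
    (W.facePairing e).linkTriangles c = {a | cuspAt e a = cuspName e c}.ncard := by
  change Nat.card _ = Nat.card _
  refine Nat.card_congr (Equiv.subtypeEquivRight fun a => ?_)
  exact (cuspName_injective e).eq_iff.symm

theorem ncard_cuspAt_mem (B : Set J) (hB : ∀ j ∈ B, W.kind j = cusped) :
    {a | ∃ j ∈ B, cuspAt e a = some j}.ncard = 2 * B.ncard := by
  have hinj : Set.InjOn (fun a : Fin n × Fin 4 => (e.symm a.1).1)
      {a | ∃ j ∈ B, cuspAt e a = some j} := by
    have hz : ∀ a ∈ {a | ∃ j ∈ B, cuspAt e a = some j}, a.2 = 0 := by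
      rintro a ⟨j, -, h⟩
      rw [cuspAt] at h
      split_ifs at h with hc
      exact hc.2.1
    intro a ha b hb h
    exact Prod.ext (e.symm.injective (Subtype.ext h)) ((hz a ha).trans (hz b hb).symm)
  have himage : (fun a : Fin n × Fin 4 => (e.symm a.1).1) ''
      {a | ∃ j ∈ B, cuspAt e a = some j} = B ×ˢ {0, 4} := by
    ext ⟨j, t⟩
    constructor
    · rintro ⟨a, ⟨j', hj', h⟩, ha⟩
      simp only at ha
      rw [cuspAt, ha] at h
      split_ifs at h with hc
      rw [← Option.some.inj h] at hj'
      exact ⟨hj', hc.2.2⟩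
    · rintro ⟨hj, ht⟩
      simp only at hj ht
      have hlt : t.val < size (W.kind j) := by
        rw [hB j hj]; exact t.isLt
      refine ⟨(e ⟨(j, t), hlt⟩, 0), ⟨j, hj, ?_⟩, by simp⟩
      rw [cuspAt, if_pos]
      · simp
      · simp only [Equiv.symm_apply_apply]
        exact ⟨hB j hj, rfl, ht⟩
  rw [← hinj.ncard_image, himage, Set.ncard_prod,
    Set.ncard_pair (by decide), mul_comm]

theorem eulerChar2_of_some [Finite J] {c : (W.facePairing e).VertexClass} {j : J}
    (h : cuspName e c = some j) : (W.facePairing e).eulerChar2 c = 0 := by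
  have hj := kind_eq_cusped_of_cuspName e h
  have h₁ : (W.facePairing e).linkVertices c = 1 := by
    rw [linkVertices_eq, h, Set.ncard_eq_one]
    refine ⟨(j, 3), Set.ext fun x => ?_⟩
    rw [Set.mem_inter_iff, mem_range_linkName, Set.mem_ofPred_eq, cuspOf, Set.mem_singleton_iff]
    constructor
    · rintro ⟨-, hx⟩
      split_ifs at hx with h3
      exact Prod.ext (Option.some.inj hx) h3
    · rintro rfl
      exact ⟨⟨fun h => absurd h (by simp), fun _ => hj⟩, rfl⟩
  have h₂ : (W.facePairing e).linkTriangles c = 2 := by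
    have := ncard_cuspAt_mem e {j} (by rintro _ rfl; exact hj)
    rw [linkTriangles_eq, h]
    simpa using this
  rw [FacePairing.eulerChar2, h₁, h₂]
  norm_num

theorem eulerChar2_of_none [Finite J] {c : (W.facePairing e).VertexClass}
    (h : cuspName e c = none) : (W.facePairing e).eulerChar2 c =
      4 + 4 * ({j | W.kind j = cusped}.ncard : ℤ) - 4 * n := by
  have h₁ : (W.facePairing e).linkVertices c = 2 + {j | W.kind j = cusped}.ncard := by
    have hset : Set.range (linkName e) ∩ {x | cuspOf x = cuspName e c} =
        {(W.root, 0), (W.root, 1)} ∪ (fun j => (j, 2)) '' {j | W.kind j = cusped} := by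
      ext ⟨j, m⟩
      rw [Set.mem_inter_iff, mem_range_linkName, Set.mem_ofPred_eq, cuspOf, h]
      fin_cases m <;> simp
    rw [linkVertices_eq, hset, Set.ncard_union_eq, Set.ncard_pair (by simp),
      Set.ncard_image_of_injective _ (fun a b hab => congrArg Prod.fst hab)]
    rw [Set.disjoint_left]
    rintro _ (rfl | rfl) ⟨j, -, hj⟩
    · exact absurd (congrArg Prod.snd hj) (by simp)
    · exact absurd (congrArg Prod.snd hj) (by simp)
  have h₂ : (W.facePairing e).linkTriangles c + 2 * {j | W.kind j = cusped}.ncard = 4 * n := by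
    have := ncard_cuspAt_mem e {j | W.kind j = cusped} (fun _ h => h)
    have hset : {a | ∃ j ∈ {j | W.kind j = cusped}, cuspAt e a = some j} =
        {a | cuspAt e a = cuspName e c}ᶜ := by
      ext a
      rw [Set.mem_compl_iff, Set.mem_ofPred_eq, Set.mem_ofPred_eq, h]
      constructor
      · rintro ⟨j, -, hj⟩
        simp [hj]
      · intro ha
        obtain ⟨j, hj⟩ := Option.ne_none_iff_exists'.1 ha
        exact ⟨j, kind_eq_cusped_of_cuspName e (c := Quot.mk _ a) hj, hj⟩
    rw [linkTriangles_eq, ← this, hset, Set.ncard_add_ncard_compl]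
    simp [Nat.card_eq_fintype_card, mul_comm]
  rw [FacePairing.eulerChar2, h₁]
  push_cast
  have : ((W.facePairing e).linkTriangles c : ℤ) + 2 * ({j | W.kind j = cusped}.ncard : ℤ) =
    4 * n := by exact_mod_cast h₂
  linarith

theorem facePairing_boundaryIs [Finite J] {g k : ℕ} (hn : n = g + k)
    (hk : {j | W.kind j = cusped}.ncard = k) : (W.facePairing e).BoundaryIs g k := by
  refine ⟨by rw [card_vertexClass, hk], ?_⟩
  obtain ⟨c₀, hc₀⟩ : none ∈ Set.range (cuspName e) := by
    rw [range_cuspName]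
    exact Or.inl rfl
  refine ⟨c₀, ?_, fun c hc => ?_⟩
  · rw [eulerChar2_of_none e hc₀, hk, hn]
    push_cast
    ring
  · cases h : cuspName e c with
    | none => exact absurd (cuspName_injective e (h.trans hc₀.symm)) hc
    | some j => exact eulerChar2_of_some e h

end Wiring

namespace FacePairing

variable {n : ℕ} {P Q R : FacePairing n}

/-- The pair `θ`, `ρ` is an isomorphism from `P` to `Q`. -/
def IsIso (P Q : FacePairing n) (θ : Equiv.Perm (Fin n)) (ρ : Fin n → Equiv.Perm (Fin 4)) :
    Prop :=
  (∀ f : Fin n × Fin 4,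
    Q.pair (θ f.1, ρ f.1 f.2) = (θ (P.pair f).1, ρ (P.pair f).1 (P.pair f).2)) ∧
  (∀ f : Fin n × Fin 4,
    Q.glue (θ f.1, ρ f.1 f.2) = (ρ f.1).symm.trans ((P.glue f).trans (ρ (P.pair f).1)))

theorem IsIso.refl (P : FacePairing n) : IsIso P P 1 1 :=
  ⟨fun _ => rfl, fun _ => rfl⟩

theorem IsIso.symm {θ : Equiv.Perm (Fin n)} {ρ : Fin n → Equiv.Perm (Fin 4)}
    (h : IsIso P Q θ ρ) : IsIso Q P θ.symm (fun y => (ρ (θ.symm y)).symm) := by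
  have hp : ∀ f : Fin n × Fin 4, P.pair (θ.symm f.1, (ρ (θ.symm f.1)).symm f.2) =
      (θ.symm (Q.pair f).1, (ρ (θ.symm (Q.pair f).1)).symm (Q.pair f).2) := by
    intro f
    have := h.1 (θ.symm f.1, (ρ (θ.symm f.1)).symm f.2)
    simp only [Equiv.apply_symm_apply, Prod.mk.eta] at this
    simp [this]
  refine ⟨hp, fun f => ?_⟩
  have := h.2 (θ.symm f.1, (ρ (θ.symm f.1)).symm f.2)
  rw [hp] at this
  simp only [Equiv.apply_symm_apply, Prod.mk.eta] at this
  rw [this]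
  ext
  simp

theorem IsIso.trans {θ θ' : Equiv.Perm (Fin n)} {ρ ρ' : Fin n → Equiv.Perm (Fin 4)}
    (h : IsIso P Q θ ρ) (h' : IsIso Q R θ' ρ') :
    IsIso P R (θ.trans θ') (fun x => (ρ x).trans (ρ' (θ x))) := by
  refine ⟨fun f => ?_, fun f => ?_⟩
  · have := h'.1 (θ f.1, ρ f.1 f.2)
    rw [h.1] at this
    exact this
  · have := h'.2 (θ f.1, ρ f.1 f.2)
    rw [h.1, h.2] at this
    exact this

theorem iso_equivalence : Equivalence (Iso (n := n)) where
  refl P := ⟨_, _, IsIso.refl P⟩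
  symm := fun ⟨θ, ρ, h⟩ => ⟨θ.symm, fun y => (ρ (θ.symm y)).symm, IsIso.symm h⟩
  trans := fun ⟨θ, ρ, h⟩ ⟨θ', ρ', h'⟩ =>
    ⟨θ.trans θ', fun x => (ρ x).trans (ρ' (θ x)), IsIso.trans h h'⟩

theorem IsIso.fixed {θ : Equiv.Perm (Fin n)} {ρ : Fin n → Equiv.Perm (Fin 4)}
    (h : IsIso P Q θ ρ) {f : Fin n × Fin 4} (hf : θ f.1 = f.1 ∧ ρ f.1 = 1)
    (hp : P.pair f = Q.pair f) (hg : P.glue f = Q.glue f) :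
    θ (P.pair f).1 = (P.pair f).1 ∧ ρ (P.pair f).1 = 1 := by
  have h₁ := h.1 f
  have h₂ := h.2 f
  rw [hf.1, hf.2, Equiv.Perm.one_apply, Prod.mk.eta] at h₁ h₂
  refine ⟨(congrArg Prod.fst (hp.trans h₁)).symm, ?_⟩
  rw [← hg] at h₂
  ext v
  have := congrArg (fun σ => (σ ((P.glue f).symm v)).val) h₂
  simp only [Equiv.apply_symm_apply] at this
  exact (this.trans (congrArg (fun w => (ρ (P.pair f).1 w).val)
    ((P.glue f).apply_symm_apply v))).symm

theorem IsIso.fixed_of_pair {θ : Equiv.Perm (Fin n)} {ρ : Fin n → Equiv.Perm (Fin 4)}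
    (h : IsIso P Q θ ρ) {f : Fin n × Fin 4}
    (hf : θ (P.pair f).1 = (P.pair f).1 ∧ ρ (P.pair f).1 = 1)
    (hp : P.pair f = Q.pair f) (hg : P.glue f = Q.glue f) :
    θ f.1 = f.1 ∧ ρ f.1 = 1 := by
  have := h.fixed hf (by rw [P.pair_invol, hp, Q.pair_invol])
    (by rw [P.glue_compat, hp, Q.glue_compat, hg])
  rwa [P.pair_invol] at this

theorem IsIso.pair_eq {θ : Equiv.Perm (Fin n)} {ρ : Fin n → Equiv.Perm (Fin 4)}
    (h : IsIso P Q θ ρ) (hf : ∀ x, θ x = x ∧ ρ x = 1) (f : Fin n × Fin 4) :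
    P.pair f = Q.pair f := by
  have := h.1 f
  simp only [hf] at this
  exact this.symm

end FacePairing

/-- A family of triangulations which are pairwise not isomorphic relative to a flag meets each
isomorphism class at most `24 n` times. -/
theorem card_le_mul_N {g k : ℕ} {α : Type} [Finite α] (F : α → Mgk g k) (x₀ : Fin (g + k))
    (hF : ∀ a b θ ρ, FacePairing.IsIso (F a).1 (F b).1 θ ρ → θ x₀ = x₀ → ρ x₀ = 1 → a = b)
    [Finite (Mgk g k)] : Nat.card α ≤ N g k * ((g + k) * 24) := by
  classical
  let S := Quot (fun P Q : Mgk g k => FacePairing.Iso P.1 Q.1)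
  have hS : ∀ a, ∃ (θ : Equiv.Perm (Fin (g + k))) (ρ : Fin (g + k) → Equiv.Perm (Fin 4)),
      FacePairing.IsIso (Quot.out (Quot.mk _ (F a) : S)).1 (F a).1 θ ρ := by
    intro a
    have heq : Equivalence (fun P Q : Mgk g k => FacePairing.Iso P.1 Q.1) :=
      FacePairing.iso_equivalence.comap Subtype.val
    exact heq.quot_mk_eq_iff _ _ |>.1 (Quot.out_eq (Quot.mk _ (F a) : S))
  choose θ ρ h using hS
  let Φ : α → S × (Fin (g + k) × Equiv.Perm (Fin 4)) := fun a =>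
    (Quot.mk _ (F a), (θ a).symm x₀, ρ a ((θ a).symm x₀))
  have hΦ : Function.Injective Φ := by
    intro a b hab
    simp only [Φ, Prod.mk.injEq] at hab
    obtain ⟨hq, hθ, hρ⟩ := hab
    have hb := h b
    rw [← hq] at hb
    refine hF a b _ _ ((h a).symm.trans hb) ?_ ?_
    · simp [hθ]
    · rw [hρ, hθ]
      exact (ρ b _).symm_trans_self
  have := Nat.card_le_card_of_injective Φ hΦ
  rwa [Nat.card_prod, Nat.card_prod, Nat.card_perm, Nat.card_fin, Nat.card_fin] at this

namespace Wiring

variable {J : Type} (W : Wiring J) {n : ℕ} (e : W.Tet ≃ Fin n)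

/-- The wiring whose second wire is obtained from the first by a relabeling `σ` of the blocks. -/
abbrev twist (σ : Equiv.Perm J) (hσ : σ W.root = W.root) : Wiring J where
  kind := W.kind
  root := W.root
  succ b := if b then σ * W.succ false * σ⁻¹ else W.succ false
  isCore_root := W.isCore_root
  eq_root := W.eq_root
  sameCycle b j := by
    cases b
    · exact W.sameCycle false j
    · simp only [if_true]
      rw [Equiv.Perm.sameCycle_conj, Equiv.Perm.inv_eq_iff_eq.2 hσ.symm]
      exact W.sameCycle false _

variable {W}

theorem eq_of_twist_succ_eq {σ σ' : Equiv.Perm J} {hσ : σ W.root = W.root}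
    {hσ' : σ' W.root = W.root} (h : (W.twist σ hσ).succ true = (W.twist σ' hσ').succ true) :
    σ = σ' := by
  simp only [if_true] at h
  ext j
  obtain ⟨m, rfl⟩ := W.sameCycle false j
  have key : ∀ σ : Equiv.Perm J, σ W.root = W.root →
      σ ((W.succ false ^ m) W.root) = ((σ * W.succ false * σ⁻¹) ^ m) W.root := by
    intro σ hσ
    rw [conj_zpow, Equiv.Perm.mul_apply, Equiv.Perm.mul_apply,
      Equiv.Perm.inv_eq_iff_eq.2 hσ.symm]
  rw [key σ hσ, key σ' hσ', h]

theorem pair_twist_eq {σ σ' : Equiv.Perm J} (hσ : σ W.root = W.root) (hσ' : σ' W.root = W.root)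
    (x : W.Tet) {i : Fin 4} (h : (W.twist σ hσ).hop x.1.2 i = (W.twist σ' hσ').hop x.1.2 i) :
    ((W.twist σ hσ).facePairing e).pair (e x, i) =
      ((W.twist σ' hσ').facePairing e).pair (e x, i) := by
  rw [facePairing_pair, facePairing_pair]
  refine Prod.ext (congrArg e (Subtype.ext (Prod.ext ?_ rfl))) rfl
  exact congrArg (fun π : Equiv.Perm J => π x.1.1) h

theorem twist_rigid [Finite J] {σ σ' : Equiv.Perm J} (hσ : σ W.root = W.root)
    (hσ' : σ' W.root = W.root) {θ : Equiv.Perm (Fin n)} {ρ : Fin n → Equiv.Perm (Fin 4)}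
    (h : FacePairing.IsIso ((W.twist σ hσ).facePairing e) ((W.twist σ' hσ').facePairing e) θ ρ)
    {x₀ : Fin n} (hx₀ : x₀ = e ⟨(W.root, 0), lt_size_of_lt_four _ 0 (by decide)⟩)
    (hθ : θ x₀ = x₀) (hρ : ρ x₀ = 1) : σ = σ' := by
  have hblock : ∀ j, (∀ h0, θ (e ⟨(j, 0), h0⟩) = e ⟨(j, 0), h0⟩ ∧ ρ (e ⟨(j, 0), h0⟩) = 1) →
      ∀ t ht, θ (e ⟨(j, t), ht⟩) = e ⟨(j, t), ht⟩ ∧ ρ (e ⟨(j, t), ht⟩) = 1 := by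
    intro j hj t ht
    obtain ⟨m, hm⟩ := exists_iterate_nbr_eq_zero _ t ht
    generalize m.val = m at hm
    induction m generalizing t with
    | zero =>
      obtain rfl : t = 0 := hm
      exact hj ht
    | succ m ih =>
      have hfree : ¬ IsFree t 1 := fun h => absurd h.1 (by decide)
      have hhop := (W.twist σ hσ).hop_of_not_isFree hfree
      have := ih (nbr (W.kind j) t 1) (nbr_lt_size _ _ _ ht) hm
      refine h.fixed_of_pair (f := (e ⟨(j, t), ht⟩, 1)) ?_
        (pair_twist_eq e hσ hσ' _
          (hhop.trans ((W.twist σ' hσ').hop_of_not_isFree hfree).symm)) rfl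
      rw [facePairing_pair]
      have hadj : (W.twist σ hσ).adj ⟨(j, t), ht⟩ 1 =
          ⟨(j, nbr (W.kind j) t 1), nbr_lt_size _ _ _ ht⟩ :=
        Subtype.ext (Prod.ext (congrArg (fun π : Equiv.Perm J => π j) hhop) rfl)
      rw [hadj]
      exact this
  have hzero : ∀ j h0, θ (e ⟨(j, 0), h0⟩) = e ⟨(j, 0), h0⟩ ∧ ρ (e ⟨(j, 0), h0⟩) = 1 := by
    intro j
    obtain ⟨m, rfl⟩ := (W.sameCycle false j).exists_nat_pow_eq
    induction m with
    | zero =>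
      intro h0
      rw [hx₀] at hθ hρ
      exact ⟨hθ, hρ⟩
    | succ m ih =>
      intro h0
      set j := (W.succ false ^ m) W.root with hj
      have h1 : (1 : Fin 7).val < size (W.kind j) := lt_size_of_lt_four _ 1 (by decide)
      have := h.fixed (f := (e ⟨(j, 1), h1⟩, 0)) (hblock j ih 1 h1)
        (pair_twist_eq e hσ hσ' _ rfl) rfl
      rw [facePairing_pair] at this
      have hnbr : ∀ u, nbr u 1 0 = 0 := by decide
      have hadj : (W.twist σ hσ).adj ⟨(j, 1), h1⟩ 0 = ⟨((W.succ false ^ (m + 1)) W.root, 0), h0⟩ :=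
        Subtype.ext (Prod.ext (congrArg (fun π : Equiv.Perm J => π W.root)
          (pow_succ' (W.succ false) m).symm) (hnbr _))
      rw [hadj] at this
      exact this
  have hall : ∀ x, θ x = x ∧ ρ x = 1 := by
    intro x
    obtain ⟨⟨⟨j, t⟩, ht⟩, rfl⟩ := e.surjective x
    exact hblock j (hzero j) t ht
  refine eq_of_twist_succ_eq (hσ := hσ) (hσ' := hσ') (Equiv.ext fun j => ?_)
  have h3 : (3 : Fin 7).val < size (W.kind j) := lt_size_of_lt_four _ 3 (by decide)
  have := h.pair_eq hall (e ⟨(j, 3), h3⟩, 0)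
  rw [facePairing_pair, facePairing_pair] at this
  exact congrArg (fun x : W.Tet => x.1.1) (e.injective (congrArg Prod.fst this))

end Wiring

/-- The kinds of blocks: one core `r`, then `k` cusped blocks, then `m` links. -/
def blockKind (r : Block) (k m : ℕ) : Fin (k + m + 1) → Block :=
  Fin.cons r (Fin.append (fun _ : Fin k => cusped) (fun _ : Fin m => link))

theorem sum_blockKind (f : Block → ℕ) (r : Block) (k m : ℕ) :
    ∑ j, f (blockKind r k m j) = f r + (k * f cusped + m * f link) := by
  simp [blockKind, Fin.sum_univ_succ, Fin.sum_univ_add]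

/-- The wiring with `k` cusped blocks and `m` links in which both wires run through the blocks in
increasing order. -/
def standardWiring (r : Block) (hr : IsCore r) (k m : ℕ) : Wiring (Fin (k + m + 1)) where
  kind := blockKind r k m
  root := 0
  succ _ := Equiv.addRight 1
  isCore_root := hr
  eq_root j hj := by
    induction j using Fin.cases with
    | zero => rfl
    | succ i =>
      rw [blockKind, Fin.cons_succ] at hj
      induction i using Fin.addCases with
      | left i => rw [Fin.append_left] at hj; exact absurd hj (by decide)
      | right i => rw [Fin.append_right] at hj; exact absurd hj (by decide)
  sameCycle _ j := by
    induction j using Fin.induction with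
    | zero => exact Equiv.Perm.SameCycle.refl _ _
    | succ i ih =>
      rw [← Fin.coeSucc_eq_succ]
      exact Equiv.Perm.sameCycle_apply_right.2 ih

theorem card_tet (r : Block) (hr : IsCore r) (k m : ℕ) :
    Nat.card (standardWiring r hr k m).Tet = size r + (k * 7 + m * 4) := by
  have hsize : ∀ u : Block, Fintype.card {t : Fin 7 // t.val < size u} = size u := by decide
  change Nat.card {x : Fin (k + m + 1) × Fin 7 // x.2.val < size (blockKind r k m x.1)} = _
  rw [Nat.card_congr (Equiv.subtypeProdEquivSigmaSubtype
    (fun j (t : Fin 7) => t.val < size (blockKind r k m j))), Nat.card_eq_fintype_card,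
    Fintype.card_sigma]
  simp only [hsize]
  exact sum_blockKind size r k m

theorem ncard_cusped (r : Block) (hr : IsCore r) (k m : ℕ) :
    {j | (standardWiring r hr k m).kind j = cusped}.ncard = k := by
  have h := sum_blockKind (fun u => if u = cusped then 1 else 0) r k m
  have hne : r ≠ cusped := by rintro rfl; exact absurd hr (by decide)
  rw [← Finset.card_filter] at h
  change {j | blockKind r k m j = cusped}.ncard = k
  rw [Set.ncard_eq_toFinset_card', Set.toFinset_ofPred]
  simpa [hne] using h

theorem FacePairing.pair_glue_injective (n : ℕ) :
    Function.Injective (fun P : FacePairing n => (P.pair, P.glue)) := by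
  rintro ⟨⟩ ⟨⟩ h
  simp_all

instance (n : ℕ) : Finite (FacePairing n) :=
  Finite.of_injective _ (FacePairing.pair_glue_injective n)

instance (g k : ℕ) : Finite (Mgk g k) := inferInstanceAs (Finite (Subtype _))

theorem factorial_le_mul_N {g k m : ℕ} {r : Block} (hr : IsCore r)
    (hn : size r + (k * 7 + m * 4) = g + k) : (k + m).factorial ≤ N g k * ((g + k) * 24) := by
  let W := standardWiring r hr k m
  let e : W.Tet ≃ Fin (g + k) := Finite.equivFinOfCardEq ((card_tet r hr k m).trans hn)
  have hroot : ∀ τ : Equiv.Perm (Fin (k + m)),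
      Equiv.Perm.decomposeFin.symm (0, τ) W.root = W.root :=
    fun τ => Equiv.Perm.decomposeFin_symm_apply_zero 0 τ
  have := card_le_mul_N (g := g) (k := k)
    (fun τ : Equiv.Perm (Fin (k + m)) => ⟨(W.twist _ (hroot τ)).facePairing e,
      Wiring.facePairing_oriented _ _,
      Wiring.facePairing_boundaryIs (W := W.twist _ (hroot τ)) e rfl (ncard_cusped r hr k m)⟩)
    (e ⟨(W.root, 0), lt_size_of_lt_four _ 0 (by decide)⟩)
    (fun τ τ' θ ρ h hθ hρ => by
      have := Wiring.twist_rigid e (hroot τ) (hroot τ') h rfl hθ hρ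
      simpa using this)
  rwa [Nat.card_perm, Nat.card_fin] at this

theorem N_le (g k : ℕ) : N g k ≤ (96 * (g + k)) ^ (4 * (g + k)) := by
  have h₁ : N g k ≤ Nat.card (Mgk g k) := Nat.card_le_card_of_surjective _ Quot.mk_surjective
  have h₂ : Nat.card (Mgk g k) ≤ Nat.card (FacePairing (g + k)) :=
    Nat.card_le_card_of_injective _ Subtype.val_injective
  have h₃ := Nat.card_le_card_of_injective _ (FacePairing.pair_glue_injective (g + k))
  rw [Nat.card_prod, Nat.card_perm, Nat.card_fun, Nat.card_prod, Nat.card_fin, Nat.card_fin,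
    show Nat.card (Fin 4 ≃ Fin 4) = 24 from by
      rw [Nat.card_perm, Nat.card_fin]; rfl] at h₃
  calc N g k ≤ _ := h₁.trans (h₂.trans h₃)
    _ ≤ ((g + k) * 4) ^ ((g + k) * 4) * 24 ^ ((g + k) * 4) :=
      Nat.mul_le_mul_right _ (Nat.factorial_le_pow _)
    _ = (96 * (g + k)) ^ (4 * (g + k)) := by
      rw [← mul_pow]
      congr 1 <;> ring

theorem N_lt_rpow {g k : ℕ} (hk : k ≤ g) (hg : 192 ≤ g) :
    (N g k : ℝ) < (g : ℝ) ^ ((17 : ℝ) * g) := by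
  have h : N g k < g ^ (17 * g) := calc
    N g k ≤ (96 * (g + k)) ^ (4 * (g + k)) := N_le g k
    _ ≤ (g ^ 2) ^ (4 * (g + k)) := Nat.pow_le_pow_left (by nlinarith) _
    _ ≤ (g ^ 2) ^ (8 * g) := Nat.pow_le_pow_right (by positivity) (by omega)
    _ = g ^ (16 * g) := by rw [← pow_mul]; congr 1; ring
    _ < g ^ (17 * g) := Nat.pow_lt_pow_right (by omega) (by omega)
  have : (g : ℝ) ^ ((17 : ℝ) * g) = ((g ^ (17 * g) : ℕ) : ℝ) := by
    rw [Nat.cast_pow, ← Real.rpow_natCast]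
    push_cast
    rfl
  rw [this]
  exact_mod_cast h

theorem pow_le_N_sq {g k : ℕ} (hg : Even g) (hk : 12 * k + 5000 ≤ g) :
    g ^ (g / 16 - 4) ≤ N g k ^ 2 := by
  obtain ⟨r, hr, m, hm⟩ : ∃ r, IsCore r ∧ ∃ m, size r + (k * 7 + m * 4) = g + k := by
    obtain ⟨a, ha⟩ := hg
    rcases Nat.even_or_odd' (a - 3 * k) with ⟨b, hb | hb⟩
    · exact ⟨smallCore, by decide, b - 1, by simp only [size]; omega⟩
    · exact ⟨largeCore, by decide, b - 1, by simp only [size]; omega⟩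
  have hsize : ∀ u, size u ≤ 7 := by decide
  have hr7 := hsize r
  set p := g / 16 with hp
  have hpm : 2 * p ≤ k + m := by omega
  have hpp : p ^ p ≤ (k + m).factorial := calc
    p ^ p ≤ p.factorial * p ^ (2 * p - p) := by
      rw [show 2 * p - p = p by omega]
      exact Nat.le_mul_of_pos_left _ p.factorial_pos
    _ ≤ (2 * p).factorial := Nat.factorial_mul_pow_sub_le_factorial (by omega)
    _ ≤ _ := Nat.factorial_le hpm
  have hgp : g ≤ p ^ 2 := by
    have : g ≤ 17 * p := by omega
    nlinarith
  have hmul : g ^ (p - 4) * g ^ 4 ≤ N g k ^ 2 * g ^ 4 := calc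
    g ^ (p - 4) * g ^ 4 = g ^ p := by rw [← pow_add]; congr 1; omega
    _ ≤ (p ^ 2) ^ p := Nat.pow_le_pow_left hgp _
    _ = (p ^ p) ^ 2 := by rw [← pow_mul, ← pow_mul, mul_comm]
    _ ≤ (N g k * ((g + k) * 24)) ^ 2 :=
      Nat.pow_le_pow_left (hpp.trans (factorial_le_mul_N hr hm)) _
    _ ≤ (N g k * g ^ 2) ^ 2 :=
      Nat.pow_le_pow_left (Nat.mul_le_mul_left _ (by nlinarith)) _
    _ = N g k ^ 2 * g ^ 4 := by ring
  exact Nat.le_of_mul_le_mul_right hmul (pow_pos (by omega) 4)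

theorem rpow_lt_N {g k : ℕ} (hg : Even g) (hk : 12 * k + 5000 ≤ g) :
    (g : ℝ) ^ ((1 / 200 : ℝ) * g) < N g k := by
  have h : (g : ℝ) ^ (g / 16 - 4) ≤ (N g k : ℝ) ^ 2 := by exact_mod_cast pow_le_N_sq hg hk
  refine lt_of_pow_lt_pow_left₀ 2 (Nat.cast_nonneg _) (lt_of_lt_of_le ?_ h)
  rw [← Real.rpow_natCast, ← Real.rpow_natCast, ← Real.rpow_mul (Nat.cast_nonneg _)]
  refine Real.rpow_lt_rpow_of_exponent_lt (by exact_mod_cast (by omega : 1 < g)) ?_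
  have : g < 100 * (g / 16 - 4) := by omega
  have : (g : ℝ) < 100 * ((g / 16 - 4 : ℕ) : ℝ) := by exact_mod_cast this
  push_cast
  linarith

/-- There are constants `C > c > 0` such that for each fixed `k` and all sufficiently large
even `g` one has `g^{c·g} < N(g,k) < g^{C·g}`. -/
theorem Mgk_growth :
    ∃ c C : ℝ, 0 < c ∧ c < C ∧
      ∀ k : ℕ, ∃ G : ℕ, ∀ g : ℕ, Even g → G ≤ g →
        (g : ℝ) ^ (c * g) < N g k ∧ (N g k : ℝ) < (g : ℝ) ^ (C * g) := by
  exact ⟨1 / 200, 17, by norm_num, by norm_num, fun k => ⟨12 * k + 5000, fun _ hg hk =>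
    ⟨rpow_lt_N hg hk, N_lt_rpow (by omega) (by omega)⟩⟩⟩
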